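/- arXiv:2410.07222 — 3 statements merged into one kernel-verified Lean document; each statement's English description precedes it below -/
import Mathlib

section
/- For every a ∈ ℝ^N_{++}, every π ∈ Π^N and every ℓ̄ ∈ ℝ^N_+, the Eisenberg–Noe clearing map p ↦ Φ(p, a, π, ℓ̄) = (πᵀp + a) ∧ ℓ̄ has exactly one fixed point p* in ℝ^N_+, and this fixed point satisfies 0 ≤ p* ≤ ℓ̄ componentwise. -/
/-- `Π^N`: matrices with entries in `[0,1]`, zero diagonal, each row sums to `0` or `1`. -/
def IsRelLiab (N : ℕ) (π : Fin N → Fin N → ℝ) : Prop :=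
  (∀ i j, 0 ≤ π i j ∧ π i j ≤ 1) ∧ (∀ i, π i i = 0) ∧
  ∀ i, (∑ j, π i j) = 0 ∨ (∑ j, π i j) = 1

/-- The Eisenberg–Noe clearing map `Φ(p, a, π, ℓ̄) = (πᵀp + a) ∧ ℓ̄`. -/
noncomputable def Phi {N : ℕ} (π : Fin N → Fin N → ℝ) (a lb p : Fin N → ℝ) : Fin N → ℝ :=
  fun i => min ((∑ j, π j i * p j) + a i) (lb i)

/-- The Eisenberg–Noe clearing map is monotone when the liability matrix is nonnegative. -/
theorem Phi_mono {N : ℕ} {π : Fin N → Fin N → ℝ} (hπ : ∀ i j, 0 ≤ π i j)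
    (a lb : Fin N → ℝ) : Monotone (Phi π a lb) := by
  intro p q hpq i
  unfold Phi
  gcongr with j
  · exact hπ j i
  · exact hpq j

/-- Knaster–Tarski: the clearing map has a fixed point in the box `[0, lb]`. -/
theorem exists_Phi_fixedPoint {N : ℕ} {π : Fin N → Fin N → ℝ} (hπ : ∀ i j, 0 ≤ π i j)
    {a lb : Fin N → ℝ} (ha : 0 ≤ a) (hlb : 0 ≤ lb) :
    ∃ p ∈ Set.Icc 0 lb, Phi π a lb p = p := by
  have hmaps : ∀ p ∈ Set.Icc 0 lb, Phi π a lb p ∈ Set.Icc 0 lb := fun p hp =>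
    ⟨fun i => le_min (add_nonneg (Finset.sum_nonneg fun j _ => mul_nonneg (hπ j i) (hp.1 j)) (ha i))
      (hlb i), fun i => min_le_right _ _⟩
  have : Fact (0 ≤ lb) := ⟨hlb⟩
  let f : Set.Icc 0 lb →o Set.Icc 0 lb :=
    ⟨fun p => ⟨Phi π a lb p, hmaps p p.2⟩, fun _ _ h => Phi_mono hπ a lb h⟩
  exact ⟨f.lfp, f.lfp.2, congrArg Subtype.val f.map_lfp⟩

/-- With strictly positive assets, any nonnegative fixed point of the clearing map lies below
any other. The proof scales `q` by the smallest ratio `p i / q i`. -/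
theorem Phi_fixedPoint_le {N : ℕ} {π : Fin N → Fin N → ℝ} (hπ : ∀ i j, 0 ≤ π i j)
    {a lb p q : Fin N → ℝ} (ha : ∀ i, 0 < a i) (hp : 0 ≤ p) (hq : 0 ≤ q)
    (hfp : Phi π a lb p = p) (hfq : Phi π a lb q = q) : q ≤ p := by
  by_contra hle
  obtain ⟨k, hk⟩ : ∃ k, p k < q k := by simpa [Pi.le_def] using hle
  have hqk : 0 < q k := (hp k).trans_lt hk
  obtain ⟨i, hi, hmin⟩ := Finset.exists_min_image (Finset.univ.filter fun j => 0 < q j)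
    (fun j => p j / q j) ⟨k, by simpa using hqk⟩
  simp only [Finset.mem_filter, Finset.mem_univ, true_and] at hi hmin
  set t := p i / q i with ht
  have ht0 : 0 ≤ t := div_nonneg (hp i) hi.le
  have ht1 : t < 1 := (hmin k hqk).trans_lt ((div_lt_one hqk).2 hk)
  have htq : ∀ j, t * q j ≤ p j := fun j => by
    rcases (hq j).eq_or_lt with h | h
    · rw [← h]
      simpa using hp j
    · exact (le_div_iff₀ h).1 (hmin j h)
  have hqi : min ((∑ j, π j i * q j) + a i) (lb i) = q i := congrFun hfq i
  have hpi : min ((∑ j, π j i * p j) + a i) (lb i) = p i := congrFun hfp i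
  have hsum : t * ∑ j, π j i * q j ≤ ∑ j, π j i * p j := by
    rw [Finset.mul_sum]
    refine Finset.sum_le_sum fun j _ => ?_
    rw [mul_left_comm]
    exact mul_le_mul_of_nonneg_left (htq j) (hπ j i)
  have hlt : t * q i < min ((∑ j, π j i * p j) + a i) (lb i) := by
    refine lt_min ?_ ?_
    · have := mul_le_mul_of_nonneg_left (hqi.symm.le.trans (min_le_left _ _)) ht0
      nlinarith [mul_pos (sub_pos.2 ht1) (ha i)]
    · exact (mul_lt_of_lt_one_left hi ht1).trans_le (hqi.symm.le.trans (min_le_right _ _))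
  rw [hpi, ht, div_mul_cancel₀ _ hi.ne'] at hlt
  exact hlt.false

/-- For `a ∈ ℝ^N_{++}`, `π ∈ Π^N`, `ℓ̄ ∈ ℝ^N_+`, the map `p ↦ Φ(p, a, π, ℓ̄)`
has exactly one fixed point `p*` in `ℝ^N_+`, and it satisfies `0 ≤ p* ≤ ℓ̄` componentwise. -/
theorem eisenbergNoe_unique_clearing_vector
    (N : ℕ) (hN : 1 ≤ N)
    (a : Fin N → ℝ) (ha : ∀ i, 0 < a i)
    (π : Fin N → Fin N → ℝ) (hπ : IsRelLiab N π)
    (lb : Fin N → ℝ) (hlb : ∀ i, 0 ≤ lb i) :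
    ∃ p : Fin N → ℝ,
      ((∀ i, 0 ≤ p i) ∧ Phi π a lb p = p) ∧
      (∀ i, 0 ≤ p i ∧ p i ≤ lb i) ∧
      ∀ q : Fin N → ℝ, (∀ i, 0 ≤ q i) → Phi π a lb q = q → q = p := by
  have hnn : ∀ i j, 0 ≤ π i j := fun i j => (hπ.1 i j).1
  obtain ⟨p, hp, hfp⟩ := exists_Phi_fixedPoint hnn (fun i => (ha i).le) hlb
  exact ⟨p, ⟨hp.1, hfp⟩, fun i => ⟨hp.1 i, hp.2 i⟩, fun q hq hfq =>
    le_antisymm (Phi_fixedPoint_le hnn ha hp.1 hq hfp hfq)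
      (Phi_fixedPoint_le hnn ha hq hp.1 hfq hfp)⟩
end

section
/- Fix a ∈ ℝ^N_{++} and ℓ̄ ∈ ℝ^N_+. The map f₃ : Π^N → ℝ^N that sends π to the unique fixed point in ℝ^N_+ of p ↦ Φ(p, a, π, ℓ̄) is continuous, where Π^N carries the topology induced from ℝ^{N×N}. -/
theorem Phi_le {N : ℕ} (π : Fin N → Fin N → ℝ) (a lb p : Fin N → ℝ) : Phi π a lb p ≤ lb :=
  fun _ => min_le_right _ _

theorem tendsto_Phi {N : ℕ} (a lb : Fin N → ℝ) {X : Type*} {l : Filter X}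
    {u : X → Fin N → Fin N → ℝ} {v : X → Fin N → ℝ} {π : Fin N → Fin N → ℝ} {q : Fin N → ℝ}
    (hu : Filter.Tendsto u l (nhds π)) (hv : Filter.Tendsto v l (nhds q)) :
    Filter.Tendsto (fun x => Phi (u x) a lb (v x)) l (nhds (Phi π a lb q)) :=
  tendsto_pi_nhds.2 fun i =>
    ((tendsto_finsetSum _ fun j _ =>
      (((hu.apply_nhds j).apply_nhds i).mul (hv.apply_nhds j))).add_const (a i)).min
      tendsto_const_nhds

/-- Fix `a ∈ ℝ^N_{++}` and `ℓ̄ ∈ ℝ^N_+`.  The map sending `π ∈ Π^N` to the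
unique nonnegative fixed point of `p ↦ Φ(p, a, π, ℓ̄)` is continuous on `Π^N` (with the
topology induced from `ℝ^{N×N}`). -/
theorem clearing_vector_continuous_in_pi
    (N : ℕ) (hN : 1 ≤ N)
    (a : Fin N → ℝ) (ha : ∀ i, 0 < a i)
    (lb : Fin N → ℝ) (hlb : ∀ i, 0 ≤ lb i)
    (f : (Fin N → Fin N → ℝ) → (Fin N → ℝ))
    (hf : ∀ π : Fin N → Fin N → ℝ, IsRelLiab N π →
      (∀ i, 0 ≤ f π i) ∧ Phi π a lb (f π) = f π ∧
      ∀ q : Fin N → ℝ, (∀ i, 0 ≤ q i) → Phi π a lb q = q → q = f π) :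
    ContinuousOn f {π : Fin N → Fin N → ℝ | IsRelLiab N π} := by
  intro π hπ
  have hmem : ∀ᶠ x in nhdsWithin π {π | IsRelLiab N π}, f x ∈ Set.Icc 0 lb := by
    filter_upwards [self_mem_nhdsWithin] with x hx
    obtain ⟨h_nonneg, h_fix, -⟩ := hf x hx
    exact ⟨h_nonneg, h_fix ▸ Phi_le x a lb (f x)⟩
  refine isCompact_Icc.tendsto_nhds_of_unique_mapClusterPt hmem fun q hq hclus => ?_
  refine (hf π hπ).2.2 q hq.1 ?_
  obtain ⟨U, hU, hfU⟩ := mapClusterPt_iff_ultrafilter.1 hclus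
  have hPhi := tendsto_Phi a lb (tendsto_nhdsWithin_iff.1 hU).1 hfU
  refine tendsto_nhds_unique hPhi (hfU.congr' ?_)
  filter_upwards [hU self_mem_nhdsWithin] with x hx
  exact (hf x hx).2.1.symm
end

section
/- Fix a ∈ ℝ^N_{++}. The clearing vector function ℓ ↦ CV(a, ℓ) is continuous on the set of N×N matrices with nonnegative entries and zero diagonal (with the topology induced from ℝ^{N×N}). -/
/-- Total liability vector: `ℓ̄_i = ∑_j ℓ_{ij}`. -/
noncomputable def lbar {N : ℕ} (ℓ : Fin N → Fin N → ℝ) : Fin N → ℝ := fun i => ∑ j, ℓ i j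

/-- Relative liability matrix: `π_{ij} = ℓ_{ij}/ℓ̄_i` if `ℓ̄_i > 0`, else `0`. -/
noncomputable def relPi {N : ℕ} (ℓ : Fin N → Fin N → ℝ) : Fin N → Fin N → ℝ :=
  fun i j => if 0 < lbar ℓ i then ℓ i j / lbar ℓ i else 0

theorem lbar_nonneg {N : ℕ} {ℓ : Fin N → Fin N → ℝ} (h : ∀ i j, 0 ≤ ℓ i j) (i : Fin N) :
    0 ≤ lbar ℓ i :=
  Finset.sum_nonneg fun j _ => h i j

theorem continuous_lbar {N : ℕ} (i : Fin N) :
    Continuous fun ℓ : Fin N → Fin N → ℝ => lbar ℓ i := by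
  unfold lbar
  fun_prop

theorem relPi_nonneg {N : ℕ} {ℓ : Fin N → Fin N → ℝ} (h : ∀ i j, 0 ≤ ℓ i j) (i j : Fin N) :
    0 ≤ relPi ℓ i j := by
  unfold relPi
  split_ifs with hi
  · exact div_nonneg (h i j) hi.le
  · exact le_rfl

theorem relPi_le_one {N : ℕ} {ℓ : Fin N → Fin N → ℝ} (h : ∀ i j, 0 ≤ ℓ i j) (i j : Fin N) :
    relPi ℓ i j ≤ 1 := by
  unfold relPi
  split_ifs with hi
  · exact (div_le_one hi).2 (Finset.single_le_sum (fun k _ => h i k) (Finset.mem_univ j))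
  · exact zero_le_one

/-- Although `relPi` is discontinuous where a total liability vanishes, the payments
`relPi ℓ j i * p j` depend continuously on `(ℓ, p)` in the region `0 ≤ p ≤ lbar ℓ`. -/
theorem tendsto_relPi_mul {N : ℕ} {F : Filter (Fin N → Fin N → ℝ)} [F.NeBot]
    {x : Fin N → Fin N → ℝ} {p : (Fin N → Fin N → ℝ) → ℝ} {y : ℝ} (j i : Fin N)
    (hx : ∀ i j, 0 ≤ x i j) (hF : Filter.Tendsto id F (nhds x))
    (hp : Filter.Tendsto p F (nhds y))
    (hmem : ∀ᶠ ℓ in F, (∀ i j, 0 ≤ ℓ i j) ∧ 0 ≤ p ℓ ∧ p ℓ ≤ lbar ℓ j) :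
    Filter.Tendsto (fun ℓ => relPi ℓ j i * p ℓ) F (nhds (relPi x j i * y)) := by
  have hl : Filter.Tendsto (fun ℓ => lbar ℓ j) F (nhds (lbar x j)) :=
    ((continuous_lbar j).tendsto x).comp hF
  rcases (lbar_nonneg hx j).lt_or_eq with hpos | hzero
  · refine Filter.Tendsto.mul ?_ hp
    have hij : Filter.Tendsto (fun ℓ : Fin N → Fin N → ℝ => ℓ j i) F (nhds (x j i)) :=
      ((continuous_apply_apply j i).tendsto x).comp hF
    have hlim : relPi x j i = x j i / lbar x j := if_pos hpos
    rw [hlim]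
    refine (hij.div hl hpos.ne').congr' ?_
    filter_upwards [hl.eventually_const_lt hpos] with ℓ hℓ
    exact (if_pos hℓ).symm
  · have hy : y = 0 := le_antisymm
      (hzero ▸ le_of_tendsto_of_tendsto hp hl (hmem.mono fun ℓ h => h.2.2))
      (ge_of_tendsto hp (hmem.mono fun ℓ h => h.2.1))
    subst hy
    rw [mul_zero]
    refine tendsto_of_tendsto_of_tendsto_of_le_of_le' tendsto_const_nhds hp ?_ ?_
    · filter_upwards [hmem] with ℓ h using mul_nonneg (relPi_nonneg h.1 j i) h.2.1
    · filter_upwards [hmem] with ℓ h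
      exact mul_le_of_le_one_left h.2.1 (relPi_le_one h.1 j i)

/-- Fix `a ∈ ℝ^N_{++}`.  The clearing vector function `ℓ ↦ CV(a, ℓ)` is
continuous on the set of `N×N` matrices with nonnegative entries and zero diagonal. -/
theorem clearing_vector_continuous_in_liability_matrix
    (N : ℕ) (hN : 1 ≤ N)
    (a : Fin N → ℝ) (ha : ∀ i, 0 < a i)
    (CV : (Fin N → Fin N → ℝ) → (Fin N → ℝ))
    (hCV : ∀ ℓ : Fin N → Fin N → ℝ, (∀ i j, 0 ≤ ℓ i j) → (∀ i, ℓ i i = 0) →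
      (∀ i, 0 ≤ CV ℓ i) ∧ Phi (relPi ℓ) a (lbar ℓ) (CV ℓ) = CV ℓ ∧
      ∀ q : Fin N → ℝ, (∀ i, 0 ≤ q i) → Phi (relPi ℓ) a (lbar ℓ) q = q → q = CV ℓ) :
    ContinuousOn CV {ℓ : Fin N → Fin N → ℝ | (∀ i j, 0 ≤ ℓ i j) ∧ ∀ i, ℓ i i = 0} := by
  rintro x ⟨hx, hx0⟩
  set S := {ℓ : Fin N → Fin N → ℝ | (∀ i j, 0 ≤ ℓ i j) ∧ ∀ i, ℓ i i = 0} with hS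
  have hbound : ∀ ℓ ∈ S, ∀ i, CV ℓ i ≤ lbar ℓ i := fun ℓ hℓ i => by
    rw [← congrFun (hCV ℓ hℓ.1 hℓ.2).2.1 i]
    exact min_le_right _ _
  have hmemS : ∀ᶠ ℓ in nhdsWithin x S, ℓ ∈ S := self_mem_nhdsWithin
  have hK : ∀ᶠ ℓ in nhdsWithin x S, CV ℓ ∈ Set.Icc 0 (fun i => lbar x i + 1) := by
    have hlt : ∀ᶠ ℓ in nhdsWithin x S, ∀ i, lbar ℓ i < lbar x i + 1 :=
      Filter.eventually_all.2 fun i => nhdsWithin_le_nhds <|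
        ((continuous_lbar i).tendsto x).eventually_lt_const (lt_add_one _)
    filter_upwards [hlt, hmemS] with ℓ h hℓ
    exact ⟨(hCV ℓ hℓ.1 hℓ.2).1, fun i => (hbound ℓ hℓ i).trans (h i).le⟩
  refine isCompact_Icc.tendsto_nhds_of_unique_mapClusterPt hK fun y hy hcl => ?_
  obtain ⟨U, hU, hUy⟩ := mapClusterPt_iff_ultrafilter.1 hcl
  have hUS : ∀ᶠ ℓ in (U : Filter _), ℓ ∈ S := hU hmemS
  have hUx : Filter.Tendsto id (U : Filter _) (nhds x) := hU.trans nhdsWithin_le_nhds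
  refine (hCV x hx hx0).2.2 y hy.1 (funext fun i => ?_)
  have hPhi : Filter.Tendsto (fun ℓ => Phi (relPi ℓ) a (lbar ℓ) (CV ℓ) i) U
      (nhds (Phi (relPi x) a (lbar x) y i)) := by
    refine Filter.Tendsto.min (Filter.Tendsto.add_const _ (tendsto_finsetSum _ fun j _ => ?_))
      (((continuous_lbar i).tendsto x).comp hUx)
    refine tendsto_relPi_mul j i hx hUx (tendsto_pi_nhds.1 hUy j) ?_
    filter_upwards [hUS] with ℓ hℓ
    exact ⟨hℓ.1, (hCV ℓ hℓ.1 hℓ.2).1 j, hbound ℓ hℓ j⟩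
  refine tendsto_nhds_unique (hPhi.congr' ?_) (tendsto_pi_nhds.1 hUy i)
  filter_upwards [hUS] with ℓ hℓ using congrFun (hCV ℓ hℓ.1 hℓ.2).2.1 i
end
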